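/- Let d ≥ 1 and m ≥ 1 be integers, K > 0 and 0 < ε ≤ K. Let c : ℝᵈ → ℝᵈ be (m+1) times continuously differentiable with |∂^γ c^i(x)| ≤ ε for all x, all 1 ≤ i ≤ d and all multi-indices γ with |γ| ≤ m+1, and suppose |det(𝕀 + θ·Dc(x))| ≥ K⁻¹ for all x ∈ ℝᵈ and θ ∈ [0,1]. Then there exists a constant N depending only on m, d and K such that for every (m+1) times continuously differentiable, compactly supported function u : ℝᵈ → ℝ and every multi-index α with |α| ≤ m: | ∫_{ℝᵈ} | ∂^α( u(· + c(·)) )(x) |² dx − ∫_{ℝᵈ} |∂^α u(x)|² dx | ≤ N ε Σ_{|ζ| ≤ m} ∫_{ℝᵈ} |∂^ζ u(x)|² dx. -/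

import Mathlib

open MeasureTheory Finset
open scoped ENNReal

/-- Partial derivative in direction `i`. -/
noncomputable def pd {d : ℕ} (i : Fin d) (f : EuclideanSpace ℝ (Fin d) → ℝ) :
    EuclideanSpace ℝ (Fin d) → ℝ :=
  fun x => fderiv ℝ f x (EuclideanSpace.single i 1)

/-- Multi-index partial derivative `∂^ζ`. -/
noncomputable def mpd {d : ℕ} (ζ : Fin d → ℕ) (f : EuclideanSpace ℝ (Fin d) → ℝ) :
    EuclideanSpace ℝ (Fin d) → ℝ :=
  (List.finRange d).foldr (fun i g => (pd i)^[ζ i] g) f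

/-- Jacobian matrix of a map `ℝᵈ → ℝᵈ`. -/
noncomputable def jac {d : ℕ} (c : EuclideanSpace ℝ (Fin d) → EuclideanSpace ℝ (Fin d))
    (x : EuclideanSpace ℝ (Fin d)) : Matrix (Fin d) (Fin d) ℝ :=
  Matrix.of fun i j => fderiv ℝ (fun y => c y i) x (EuclideanSpace.single j 1)

/-- The finite set of multi-indices `ζ ∈ ℕᵈ` with `|ζ| ≤ n`. -/
def midx (d n : ℕ) : Finset (Fin d → ℕ) :=
  (Finset.univ.image (fun f : Fin d → Fin (n + 1) => fun i => (f i : ℕ))).filter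
    (fun ζ => ∑ i, ζ i ≤ n)

/-- Iterated partial derivative along a list of directions, the head being applied first. -/
noncomputable def dlist {d : ℕ} (L : List (Fin d)) (f : EuclideanSpace ℝ (Fin d) → ℝ) :
    EuclideanSpace ℝ (Fin d) → ℝ :=
  L.foldl (fun g i => pd i g) f

section PartialDerivatives

variable {d : ℕ}

@[simp] lemma dlist_nil (f : EuclideanSpace ℝ (Fin d) → ℝ) : dlist [] f = f := rfl

@[simp] lemma dlist_cons (i : Fin d) (L : List (Fin d)) (f : EuclideanSpace ℝ (Fin d) → ℝ) :
    dlist (i :: L) f = dlist L (pd i f) := rfl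

lemma contDiff_pd {n : ℕ} {f : EuclideanSpace ℝ (Fin d) → ℝ} (hf : ContDiff ℝ (n + 1 : ℕ) f)
    (i : Fin d) : ContDiff ℝ n (pd i f) := by
  have h : ContDiff ℝ n (fderiv ℝ f) := hf.fderiv_right (by norm_cast)
  exact h.clm_apply contDiff_const

lemma contDiff_dlist {n : ℕ} (L : List (Fin d)) {f : EuclideanSpace ℝ (Fin d) → ℝ}
    (hf : ContDiff ℝ (n + L.length : ℕ) f) : ContDiff ℝ n (dlist L f) := by
  induction L generalizing f with
  | nil => simpa using hf
  | cons i L ih => exact ih (contDiff_pd hf i)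

lemma hasCompactSupport_dlist (L : List (Fin d)) {f : EuclideanSpace ℝ (Fin d) → ℝ}
    (hf : HasCompactSupport f) : HasCompactSupport (dlist L f) := by
  induction L generalizing f with
  | nil => exact hf
  | cons i L ih => exact ih (hf.fderiv_apply ℝ _)

lemma pd_add {f g : EuclideanSpace ℝ (Fin d) → ℝ} (hf : Differentiable ℝ f)
    (hg : Differentiable ℝ g) (i : Fin d) :
    pd i (fun x => f x + g x) = fun x => pd i f x + pd i g x := by
  ext x
  simp only [pd]
  rw [fderiv_fun_add (hf x) (hg x)]
  rfl

lemma pd_mul {f g : EuclideanSpace ℝ (Fin d) → ℝ} (hf : Differentiable ℝ f)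
    (hg : Differentiable ℝ g) (i : Fin d) :
    pd i (fun x => f x * g x) = fun x => pd i f x * g x + f x * pd i g x := by
  ext x
  simp only [pd]
  rw [fderiv_fun_mul (hf x) (hg x)]
  simp only [add_apply, smul_apply, smul_eq_mul]
  ring

lemma differentiable_of_contDiff_succ {n : ℕ} {F : Type*} [NormedAddCommGroup F] [NormedSpace ℝ F]
    {f : EuclideanSpace ℝ (Fin d) → F} (hf : ContDiff ℝ (n + 1 : ℕ) f) : Differentiable ℝ f :=
  hf.differentiable (by norm_cast)

lemma dlist_add (L : List (Fin d)) {f g : EuclideanSpace ℝ (Fin d) → ℝ}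
    (hf : ContDiff ℝ L.length f) (hg : ContDiff ℝ L.length g) :
    dlist L (fun x => f x + g x) = fun x => dlist L f x + dlist L g x := by
  induction L generalizing f g with
  | nil => rfl
  | cons i L ih =>
    simp only [dlist_cons]
    rw [pd_add (differentiable_of_contDiff_succ hf) (differentiable_of_contDiff_succ hg),
      ih (contDiff_pd hf i) (contDiff_pd hg i)]

lemma dlist_zero (L : List (Fin d)) : dlist L (fun _ => (0 : ℝ)) = fun _ => 0 := by
  induction L with
  | nil => rfl
  | cons i L ih =>
    have h : pd i (fun _ : EuclideanSpace ℝ (Fin d) => (0 : ℝ)) = fun _ => 0 := by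
      ext x
      simp [pd]
    rw [dlist_cons, h, ih]

lemma dlist_sum {ι : Type*} (L : List (Fin d)) (s : Finset ι)
    {f : ι → EuclideanSpace ℝ (Fin d) → ℝ} (hf : ∀ j, ContDiff ℝ L.length (f j)) :
    dlist L (fun x => ∑ j ∈ s, f j x) = fun x => ∑ j ∈ s, dlist L (f j) x := by
  classical
  induction s using Finset.induction_on with
  | empty => simpa using dlist_zero L
  | insert a s ha ih =>
    simp only [Finset.sum_insert ha]
    rw [dlist_add L (hf a) (ContDiff.sum fun j _ => hf j), ih]

/-- Pointwise bound for the derivatives of a product. -/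
lemma abs_dlist_mul_le (n : ℕ) {f g : EuclideanSpace ℝ (Fin d) → ℝ} (hf : ContDiff ℝ n f)
    (hg : ContDiff ℝ n g) {x : EuclideanSpace ℝ (Fin d)} {A B : ℝ}
    (hA : ∀ M : List (Fin d), M.length ≤ n → |dlist M f x| ≤ A)
    (hB : ∀ M : List (Fin d), M.length ≤ n → |dlist M g x| ≤ B)
    {L : List (Fin d)} (hL : L.length ≤ n) :
    |dlist L (fun y => f y * g y) x| ≤ 2 ^ n * A * B := by
  induction n generalizing f g L with
  | zero =>
    obtain rfl : L = [] := List.length_eq_zero_iff.mp (by omega)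
    have h1 := hA [] (by simp)
    have h2 := hB [] (by simp)
    simp only [dlist_nil] at h1 h2 ⊢
    rw [abs_mul, pow_zero, one_mul]
    exact mul_le_mul h1 h2 (abs_nonneg _) ((abs_nonneg _).trans h1)
  | succ n ih =>
    have hA0 : 0 ≤ A := (abs_nonneg _).trans (hA [] (by simp))
    have hB0 : 0 ≤ B := (abs_nonneg _).trans (hB [] (by simp))
    have hf' : ContDiff ℝ n f := hf.of_le (by norm_cast; omega)
    have hg' : ContDiff ℝ n g := hg.of_le (by norm_cast; omega)
    cases L with
    | nil =>
      refine (ih hf' hg' (fun M hM => hA M (by omega)) (fun M hM => hB M (by omega))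
        (L := []) (by simp)).trans ?_
      gcongr <;> norm_num
    | cons i L =>
      have hL' : L.length ≤ n := by simpa using hL
      have hle : (L.length : WithTop ℕ∞) ≤ n := by norm_cast
      rw [dlist_cons, pd_mul (differentiable_of_contDiff_succ hf)
        (differentiable_of_contDiff_succ hg),
        dlist_add L (((contDiff_pd hf i).mul hg').of_le hle)
          ((hf'.mul (contDiff_pd hg i)).of_le hle)]
      have h1 := ih (contDiff_pd hf i) hg' (fun M hM => hA (i :: M) (by simpa using hM))
        (fun M hM => hB M (by omega)) hL'
      have h2 := ih hf' (contDiff_pd hg i) (fun M hM => hA M (by omega))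
        (fun M hM => hB (i :: M) (by simpa using hM)) hL'
      calc _ ≤ _ := abs_add_le _ _
        _ ≤ 2 ^ n * A * B + 2 ^ n * A * B := add_le_add h1 h2
        _ = 2 ^ (n + 1) * A * B := by ring

lemma pd_comp_add {v : EuclideanSpace ℝ (Fin d) → ℝ}
    {c : EuclideanSpace ℝ (Fin d) → EuclideanSpace ℝ (Fin d)} (hv : Differentiable ℝ v)
    (hc : Differentiable ℝ c) (i : Fin d) :
    pd i (fun y => v (y + c y)) = fun x => pd i v (x + c x) +
      ∑ j, pd j v (x + c x) * pd i (fun y => c y j) x := by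
  ext x
  have hT : HasFDerivAt (fun y => y + c y) (ContinuousLinearMap.id ℝ _ + fderiv ℝ c x) x :=
    (hasFDerivAt_id x).add (hc x).hasFDerivAt
  have hcomp : HasFDerivAt (fun y => v (y + c y)) _ x := (hv (x + c x)).hasFDerivAt.comp x hT
  have hcj (j : Fin d) : pd i (fun y => c y j) x = fderiv ℝ c x (EuclideanSpace.single i 1) j := by
    have h := (EuclideanSpace.proj j : EuclideanSpace ℝ (Fin d) →L[ℝ] ℝ).hasFDerivAt.comp x
      (hc x).hasFDerivAt
    have h2 : fderiv ℝ (fun y => c y j) x = _ := h.fderiv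
    simp only [pd]
    rw [h2]
    rfl
  have hexp (w : EuclideanSpace ℝ (Fin d)) :
      fderiv ℝ v (x + c x) w = ∑ j, pd j v (x + c x) * w j := by
    conv_lhs => rw [← (EuclideanSpace.basisFun (Fin d) ℝ).sum_repr w]
    simp [pd, mul_comm]
  simp only [hcj]
  rw [← hexp]
  simp only [pd]
  rw [hcomp.fderiv]
  simp

/-- A derivative of `v (· + c ·)` differs from the shifted derivative of `v` by at most a multiple
of the size of `c`. -/
lemma exists_abs_dlist_comp_add_sub_le (d : ℕ) (K : ℝ) (hK : 0 ≤ K) (n : ℕ) :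
    ∃ N : ℝ, 0 ≤ N ∧ ∀ ε : ℝ, 0 ≤ ε → ε ≤ K →
      ∀ c : EuclideanSpace ℝ (Fin d) → EuclideanSpace ℝ (Fin d), ContDiff ℝ n c →
      ∀ x : EuclideanSpace ℝ (Fin d),
        (∀ M : List (Fin d), M.length ≤ n → ∀ i, |dlist M (fun y => c y i) x| ≤ ε) →
        ∀ v : EuclideanSpace ℝ (Fin d) → ℝ, ContDiff ℝ n v →
        ∀ A : ℝ, (∀ M : List (Fin d), M.length ≤ n → |dlist M v (x + c x)| ≤ A) →
        ∀ L : List (Fin d), L.length ≤ n →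
          |dlist L (fun y => v (y + c y)) x - dlist L v (x + c x)| ≤ N * ε * A := by
  induction n with
  | zero =>
    refine ⟨0, le_rfl, fun ε _ _ c _ x _ v _ A _ L hL => ?_⟩
    obtain rfl : L = [] := List.length_eq_zero_iff.mp (by omega)
    simp
  | succ n ih =>
    obtain ⟨N, hN, ih⟩ := ih
    refine ⟨N + d * (2 ^ n * (1 + N * K)), by positivity, ?_⟩
    intro ε hε hεK c hc x hcx v hv A hA L hL
    have hA0 : 0 ≤ A := (abs_nonneg _).trans (hA [] (by simp))
    cases L with
    | nil =>
      simp only [dlist_nil, sub_self, abs_zero]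
      positivity
    | cons i L =>
      have hL' : L.length ≤ n := by simpa using hL
      have hle : (L.length : WithTop ℕ∞) ≤ n := by norm_cast
      have hc' : ContDiff ℝ n c := hc.of_le (by norm_cast; omega)
      have hcomp (j : Fin d) : ContDiff ℝ n (fun y => pd j v (y + c y)) :=
        (contDiff_pd hv j).comp (contDiff_id.add hc')
      have hcj (j : Fin d) : ContDiff ℝ n (pd i fun y => c y j) :=
        contDiff_pd ((contDiff_euclidean.mp hc) j) i
      have key (j : Fin d) (M : List (Fin d)) (hM : M.length ≤ n) :=
        ih ε hε hεK c hc' x (fun M hM => hcx M (by omega)) (pd j v) (contDiff_pd hv j) A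
          (fun M hM => hA (j :: M) (by simpa using hM)) M hM
      have hbound (j : Fin d) (M : List (Fin d)) (hM : M.length ≤ n) :
          |dlist M (fun y => pd j v (y + c y)) x| ≤ (1 + N * K) * A := by
        have h1 := key j M hM
        have h2 := hA (j :: M) (by simpa using hM)
        rw [dlist_cons] at h2
        have h3 := abs_sub_abs_le_abs_sub (dlist M (fun y => pd j v (y + c y)) x)
          (dlist M (pd j v) (x + c x))
        have h4 : N * ε * A ≤ N * K * A := by gcongr
        linarith
      have hprod (j : Fin d) := abs_dlist_mul_le n (hcomp j) (hcj j) (hbound j)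
        (fun M hM => hcx (i :: M) (by simpa using hM) j) hL'
      rw [dlist_cons, dlist_cons, pd_comp_add (differentiable_of_contDiff_succ hv)
        (differentiable_of_contDiff_succ hc), dlist_add L ((hcomp i).of_le hle)
        (ContDiff.sum fun j _ => ((hcomp j).mul (hcj j)).of_le hle),
        dlist_sum L Finset.univ (fun j => ((hcomp j).mul (hcj j)).of_le hle), add_sub_right_comm]
      calc _ ≤ _ := abs_add_le _ _
        _ ≤ N * ε * A + ∑ _j : Fin d, 2 ^ n * ((1 + N * K) * A) * ε :=
            add_le_add (key i L hL') ((Finset.abs_sum_le_sum_abs _ _).trans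
              (Finset.sum_le_sum fun j _ => hprod j))
        _ = _ := by
            simp only [Finset.sum_const, Finset.card_univ, Fintype.card_fin, nsmul_eq_mul]
            ring

lemma pd_comm {f : EuclideanSpace ℝ (Fin d) → ℝ} (hf : ContDiff ℝ 2 f) (i j : Fin d) :
    pd i (pd j f) = pd j (pd i f) := by
  have hd : Differentiable ℝ (fderiv ℝ f) :=
    (hf.fderiv_right (m := 1) (by norm_num)).differentiable (by norm_num)
  have key (a b : Fin d) (x : EuclideanSpace ℝ (Fin d)) : pd a (pd b f) x =
      fderiv ℝ (fderiv ℝ f) x (EuclideanSpace.single a 1) (EuclideanSpace.single b 1) := by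
    have h := ((hd x).hasFDerivAt.clm_apply
      (hasFDerivAt_const (EuclideanSpace.single b (1 : ℝ)) x)).fderiv
    have h2 : fderiv ℝ (pd b f) x = _ := h
    rw [pd, h2]
    simp
  ext x
  rw [key, key]
  exact (hf.contDiffAt.isSymmSndFDerivAt (by simp)) _ _

lemma dlist_perm {L L' : List (Fin d)} (h : L.Perm L') {f : EuclideanSpace ℝ (Fin d) → ℝ}
    (hf : ContDiff ℝ L.length f) : dlist L f = dlist L' f := by
  induction h generalizing f with
  | nil => rfl
  | cons i _ ih => exact ih (contDiff_pd hf i)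
  | swap i j L =>
    simp only [dlist_cons]
    rw [pd_comm (hf.of_le (by simp only [List.length_cons]; norm_cast; omega))]
  | trans h₁ _ ih₁ ih₂ => rw [ih₁ hf, ih₂ (by rwa [← h₁.length_eq])]

/-- The list of directions used in `mpd ζ`. -/
def dirs (ζ : Fin d → ℕ) : List (Fin d) :=
  ((List.finRange d).flatMap fun i => List.replicate (ζ i) i).reverse

lemma mpd_eq_dlist (ζ : Fin d → ℕ) (f : EuclideanSpace ℝ (Fin d) → ℝ) :
    mpd ζ f = dlist (dirs ζ) f := by
  unfold mpd dlist dirs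
  rw [List.foldl_reverse]
  induction List.finRange d with
  | nil => rfl
  | cons i l ih =>
    rw [List.foldr_cons, List.flatMap_cons, List.foldr_append, ← ih]
    generalize List.foldr (fun i g => (pd i)^[ζ i] g) f l = g
    induction ζ i with
    | zero => rfl
    | succ k hk => rw [Function.iterate_succ_apply', List.replicate_succ, List.foldr_cons, ← hk]

lemma count_dirs (ζ : Fin d → ℕ) (i : Fin d) : (dirs ζ).count i = ζ i := by
  unfold dirs
  rw [List.count_reverse, List.count_flatMap]
  simp only [Function.comp_def, List.count_replicate]
  rw [← List.ofFn_eq_map, List.sum_ofFn]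
  simp

lemma sum_count (L : List (Fin d)) : ∑ i, L.count i = L.length := by
  simpa using Multiset.sum_count_eq_card (s := Finset.univ) (m := (L : Multiset (Fin d)))
    (by simp)

lemma length_dirs (ζ : Fin d → ℕ) : (dirs ζ).length = ∑ i, ζ i := by
  simp [← sum_count, count_dirs]

lemma dlist_eq_mpd (L : List (Fin d)) {f : EuclideanSpace ℝ (Fin d) → ℝ}
    (hf : ContDiff ℝ L.length f) : dlist L f = mpd (fun i => L.count i) f := by
  rw [mpd_eq_dlist]
  exact dlist_perm (List.perm_iff_count.mpr fun i =>
    (count_dirs (fun i => L.count i) i).symm) hf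

lemma mem_midx {n : ℕ} {ζ : Fin d → ℕ} : ζ ∈ midx d n ↔ ∑ i, ζ i ≤ n := by
  simp only [midx, Finset.mem_filter, Finset.mem_image, Finset.mem_univ, true_and,
    and_iff_right_iff_imp]
  intro h
  refine ⟨fun i => ⟨ζ i, ?_⟩, rfl⟩
  have := Finset.single_le_sum (f := ζ) (fun _ _ => Nat.zero_le _) (Finset.mem_univ i)
  omega

end PartialDerivatives

section GlobalInverse

variable {E : Type*} [NormedAddCommGroup E] [NormedSpace ℝ E] [FiniteDimensional ℝ E]

/-- Bounded operators with determinant bounded away from zero have uniformly bounded inverses. -/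
lemma exists_norm_symm_le (r δ : ℝ) (hδ : 0 < δ) :
    ∃ R : ℝ, 0 ≤ R ∧ ∀ A : E →L[ℝ] E, ‖A‖ ≤ r → δ ≤ |A.det| →
      ∃ e : E ≃L[ℝ] E, (e : E →L[ℝ] E) = A ∧ ‖(e.symm : E →L[ℝ] E)‖ ≤ R := by
  have hdet : Continuous fun A : E →L[ℝ] E => |A.det| :=
    ContinuousLinearMap.continuous_det.abs
  have hcompact : IsCompact {A : E →L[ℝ] E | ‖A‖ ≤ r ∧ δ ≤ |A.det|} := by
    refine Metric.isCompact_of_isClosed_isBounded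
      ((isClosed_le continuous_norm continuous_const).inter (isClosed_le continuous_const hdet))
      ((Metric.isBounded_closedBall (x := 0) (r := r)).subset fun A hA => ?_)
    simpa using hA.1
  have hunit (A : E →L[ℝ] E) (hA : δ ≤ |A.det|) : A.det ≠ 0 := by
    intro h
    rw [h, abs_zero] at hA
    linarith
  have hcont : ContinuousOn (Ring.inverse : (E →L[ℝ] E) → (E →L[ℝ] E))
      {A : E →L[ℝ] E | ‖A‖ ≤ r ∧ δ ≤ |A.det|} := by
    intro A hA
    have h := NormedRing.inverse_continuousAt
      (ContinuousLinearEquiv.toUnit (A.toContinuousLinearEquivOfDetNeZero (hunit A hA.2)))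
    have h2 : ((ContinuousLinearEquiv.toUnit
        (A.toContinuousLinearEquivOfDetNeZero (hunit A hA.2)) : (E →L[ℝ] E)ˣ) : E →L[ℝ] E) = A :=
      A.coe_toContinuousLinearEquivOfDetNeZero (hunit A hA.2)
    rw [h2] at h
    exact h.continuousWithinAt
  obtain ⟨R, hR⟩ := hcompact.exists_bound_of_continuousOn hcont
  refine ⟨max R 0, le_max_right _ _, fun A hA hAδ => ?_⟩
  refine ⟨A.toContinuousLinearEquivOfDetNeZero (hunit A hAδ),
    A.coe_toContinuousLinearEquivOfDetNeZero (hunit A hAδ), ?_⟩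
  have h := hR A ⟨hA, hAδ⟩
  rw [ContinuousLinearMap.ringInverse_eq_inverse] at h
  nth_rewrite 1 [← A.coe_toContinuousLinearEquivOfDetNeZero (hunit A hAδ)] at h
  rw [ContinuousLinearMap.inverse_equiv] at h
  exact h.trans (le_max_left _ _)

/-- Method of continuity: `x ↦ x + c x` is a homeomorphism if the Jacobians of
`x ↦ x + θ • c x` are uniformly nondegenerate for `θ ∈ [0, 1]`. -/
lemma exists_homeomorph_add {c : E → E} (hc : Differentiable ℝ c) {C δ : ℝ} (hδ : 0 < δ)
    (hC : ∀ x, ‖fderiv ℝ c x‖ ≤ C)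
    (hdet : ∀ x, ∀ θ ∈ Set.Icc (0 : ℝ) 1,
      δ ≤ |(ContinuousLinearMap.id ℝ E + θ • fderiv ℝ c x).det|) :
    ∃ h : E ≃ₜ E, ∀ x, h x = x + c x := by
  have hC0 : 0 ≤ C := (norm_nonneg _).trans (hC 0)
  obtain ⟨R, hR0, hR⟩ := exists_norm_symm_le (E := E) (1 + C) δ hδ
  have hcL : LipschitzWith C.toNNReal c :=
    lipschitzWith_of_nnnorm_fderiv_le hc fun x => by
      rw [← NNReal.coe_le_coe, Real.coe_toNNReal C hC0]
      exact hC x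
  have hsymm (θ : ℝ) (hθ : θ ∈ Set.Icc (0 : ℝ) 1) (h : E ≃ₜ E) (hh : ∀ x, h x = x + θ • c x) :
      LipschitzWith R.toNNReal h.symm := by
    have hder (y : E) : ∃ B : E →L[ℝ] E, HasFDerivAt h.symm B y ∧ ‖B‖ ≤ R := by
      have hT : HasFDerivAt h (ContinuousLinearMap.id ℝ E + θ • fderiv ℝ c (h.symm y))
          (h.symm y) := by
        rw [show (h : E → E) = fun x => x + θ • c x from funext hh]
        exact (hasFDerivAt_id _).add ((hc _).hasFDerivAt.const_smul θ)
      have hnorm : ‖ContinuousLinearMap.id ℝ E + θ • fderiv ℝ c (h.symm y)‖ ≤ 1 + C := by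
        refine (norm_add_le _ _).trans ?_
        refine add_le_add ContinuousLinearMap.norm_id_le ?_
        rw [norm_smul, Real.norm_of_nonneg hθ.1]
        have := mul_le_mul hθ.2 (hC (h.symm y)) (norm_nonneg _) zero_le_one
        linarith
      obtain ⟨e, he, heR⟩ := hR _ hnorm (hdet _ θ hθ)
      rw [← he] at hT
      exact ⟨_, hT.of_local_left_inverse h.symm.continuous.continuousAt
        (Filter.Eventually.of_forall h.apply_symm_apply), heR⟩
    refine lipschitzWith_of_nnnorm_fderiv_le (fun y => (hder y).choose_spec.1.differentiableAt)
      fun y => ?_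
    obtain ⟨B, hB, hBR⟩ := hder y
    rw [hB.fderiv, ← NNReal.coe_le_coe, Real.coe_toNNReal R hR0]
    exact hBR
  obtain ⟨n, hn⟩ := exists_nat_gt (R * C)
  have hn0 : (0 : ℝ) < n := (mul_nonneg hR0 hC0).trans_lt hn
  have hstep (k : ℕ) : k ≤ n → ∃ h : E ≃ₜ E, ∀ x, h x = x + ((k : ℝ) / n) • c x := by
    induction k with
    | zero => exact fun _ => ⟨Homeomorph.refl E, fun x => by simp⟩
    | succ k ih =>
      intro hk
      obtain ⟨h, hh⟩ := ih (by omega)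
      have hkn : (k : ℝ) ≤ n := by exact_mod_cast (by omega : k ≤ n)
      have hL := hcL.comp (hsymm _ ⟨by positivity, div_le_one_of_le₀ hkn hn0.le⟩ h hh)
      have happrox : ApproximatesLinearOn (fun y => y + (1 / (n : ℝ)) • c (h.symm y))
          ((ContinuousLinearEquiv.refl ℝ E : E ≃L[ℝ] E) : E →L[ℝ] E) Set.univ
          (R * C / n).toNNReal := by
        intro x _ y _
        have h1 := hL.dist_le_mul x y
        rw [dist_eq_norm, dist_eq_norm, NNReal.coe_mul, Real.coe_toNNReal C hC0,
          Real.coe_toNNReal R hR0] at h1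
        have h2 : x + (1 / (n : ℝ)) • c (h.symm x) - (y + (1 / (n : ℝ)) • c (h.symm y)) -
            ((ContinuousLinearEquiv.refl ℝ E : E ≃L[ℝ] E) : E →L[ℝ] E) (x - y) =
            (1 / (n : ℝ)) • (c (h.symm x) - c (h.symm y)) := by
          simp only [ContinuousLinearEquiv.coe_refl, ContinuousLinearMap.id_apply, smul_sub]
          abel
        rw [h2, norm_smul, Real.norm_of_nonneg (by positivity),
          Real.coe_toNNReal _ (by positivity)]
        calc _ ≤ 1 / (n : ℝ) * (C * R * ‖x - y‖) := by gcongr; exact h1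
          _ = _ := by ring
      have hsmall : Subsingleton E ∨ (R * C / n).toNNReal <
          ‖((ContinuousLinearEquiv.refl ℝ E).symm : E →L[ℝ] E)‖₊⁻¹ := by
        rcases subsingleton_or_nontrivial E with hE | hE
        · exact Or.inl hE
        · right
          have hone : ‖((ContinuousLinearEquiv.refl ℝ E).symm : E →L[ℝ] E)‖₊ = 1 := by
            ext
            simp
          rw [hone, inv_one, ← NNReal.coe_lt_coe, Real.coe_toNNReal _ (by positivity),
            NNReal.coe_one, div_lt_one hn0]
          exact hn
      refine ⟨h.trans (happrox.toHomeomorph _ hsmall), fun x => ?_⟩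
      change h x + (1 / (n : ℝ)) • c (h.symm (h x)) = _
      rw [h.symm_apply_apply, hh x, add_assoc, ← add_smul, ← add_div]
      push_cast
      rfl
  obtain ⟨h, hh⟩ := hstep n le_rfl
  exact ⟨h, fun x => by rw [hh x, div_self hn0.ne', one_smul]⟩

end GlobalInverse

section Jacobian

variable {d : ℕ}

lemma fderiv_coord {c : EuclideanSpace ℝ (Fin d) → EuclideanSpace ℝ (Fin d)}
    {x : EuclideanSpace ℝ (Fin d)} (hc : DifferentiableAt ℝ c x) (j : Fin d)
    (w : EuclideanSpace ℝ (Fin d)) : fderiv ℝ (fun y => c y j) x w = fderiv ℝ c x w j := by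
  have h := (EuclideanSpace.proj j : EuclideanSpace ℝ (Fin d) →L[ℝ] ℝ).hasFDerivAt.comp x
    hc.hasFDerivAt
  have h2 : fderiv ℝ (fun y => c y j) x = _ := h.fderiv
  rw [h2]
  rfl

lemma det_id_add_smul_fderiv {c : EuclideanSpace ℝ (Fin d) → EuclideanSpace ℝ (Fin d)}
    {x : EuclideanSpace ℝ (Fin d)} (hc : DifferentiableAt ℝ c x) (θ : ℝ) :
    (ContinuousLinearMap.id ℝ (EuclideanSpace ℝ (Fin d)) + θ • fderiv ℝ c x).det =
      ((1 : Matrix (Fin d) (Fin d) ℝ) + θ • jac c x).det := by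
  rw [ContinuousLinearMap.det, ← LinearMap.det_toMatrix (EuclideanSpace.basisFun (Fin d) ℝ).toBasis]
  congr 1
  ext i j
  simp [LinearMap.toMatrix_apply, jac, fderiv_coord hc, Matrix.one_apply]

lemma norm_le_sum_abs_entries (A : EuclideanSpace ℝ (Fin d) →L[ℝ] EuclideanSpace ℝ (Fin d)) :
    ‖A‖ ≤ ∑ j, ∑ i, |A (EuclideanSpace.single j 1) i| := by
  have hnorm (v : EuclideanSpace ℝ (Fin d)) : ‖v‖ ≤ ∑ i, |v i| := by
    conv_lhs => rw [← (EuclideanSpace.basisFun (Fin d) ℝ).sum_repr v]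
    refine (norm_sum_le _ _).trans (Finset.sum_le_sum fun i _ => ?_)
    simp [norm_smul]
  refine ContinuousLinearMap.opNorm_le_bound _ (by positivity) fun v => ?_
  conv_lhs => rw [← (EuclideanSpace.basisFun (Fin d) ℝ).sum_repr v]
  rw [map_sum, Finset.sum_mul]
  refine (norm_sum_le _ _).trans (Finset.sum_le_sum fun j _ => ?_)
  rw [map_smul, norm_smul, mul_comm]
  simp only [EuclideanSpace.basisFun_repr, EuclideanSpace.basisFun_apply]
  exact mul_le_mul (hnorm _) (PiLp.norm_apply_le v j) (norm_nonneg _) (by positivity)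

lemma exists_abs_one_sub_det_le (d : ℕ) (K : ℝ) :
    ∃ N : ℝ, 0 ≤ N ∧ ∀ ε : ℝ, 0 ≤ ε → ε ≤ K → ∀ M : Matrix (Fin d) (Fin d) ℝ,
      (∀ i j, |M i j| ≤ ε) → |(1 - |((1 : Matrix (Fin d) (Fin d) ℝ) + M).det|)| ≤ N * ε := by
  set F : (Fin d → Fin d → ℝ) → ℝ := fun M => ((1 : Matrix (Fin d) (Fin d) ℝ) + Matrix.of M).det
    with hF
  have hFs : ContDiff ℝ 1 F := by
    simp only [hF, Matrix.det_apply, Matrix.add_apply, Matrix.of_apply]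
    fun_prop
  obtain ⟨N, hN⟩ := (isCompact_closedBall (0 : Fin d → Fin d → ℝ) K).exists_bound_of_continuousOn
    (hFs.continuous_fderiv (by norm_num)).continuousOn
  refine ⟨max N 0, le_max_right _ _, fun ε hε hεK M hM => ?_⟩
  obtain ⟨P, hMP⟩ : ∃ P : Fin d → Fin d → ℝ, M = Matrix.of P := ⟨M, rfl⟩
  rw [hMP] at hM ⊢
  have hP : ‖P‖ ≤ ε :=
    (pi_norm_le_iff_of_nonneg hε).mpr fun i => (pi_norm_le_iff_of_nonneg hε).mpr fun j => hM i j
  have h := (convex_closedBall (0 : Fin d → Fin d → ℝ) K).norm_image_sub_le_of_norm_fderiv_le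
    (fun y _ => hFs.differentiable (by norm_num) y) hN
    (Metric.mem_closedBall_self (hε.trans hεK)) (mem_closedBall_zero_iff.mpr (hP.trans hεK))
  have hF0 : F 0 = 1 := by simp [hF]
  rw [sub_zero, hF0, Real.norm_eq_abs] at h
  have h1 := abs_abs_sub_abs_le 1 (F P)
  rw [abs_one] at h1
  calc _ ≤ |1 - F P| := h1
    _ ≤ N * ‖P‖ := (abs_sub_comm _ _).trans_le h
    _ ≤ max N 0 * ε := mul_le_mul (le_max_left _ _) hP (norm_nonneg _) (le_max_right _ _)

end Jacobian

lemma integral_comp_homeomorph_eq {E : Type*} [NormedAddCommGroup E] [NormedSpace ℝ E]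
    [FiniteDimensional ℝ E] [MeasurableSpace E] [BorelSpace E] (μ : Measure E)
    [μ.IsAddHaarMeasure] (h : E ≃ₜ E) {h' : E → E →L[ℝ] E} (hh : ∀ x, HasFDerivAt h (h' x) x)
    (g : E → ℝ) : ∫ x, |(h' x).det| * g (h x) ∂μ = ∫ x, g x ∂μ := by
  have key := integral_image_eq_integral_abs_det_fderiv_smul μ MeasurableSet.univ
    (fun x _ => (hh x).hasFDerivWithinAt) h.injective.injOn g
  simpa [Set.image_univ, h.surjective.range_eq] using key.symm

/-- Estimate for the difference of `L₂` norms of `∂^α(u ∘ T_c)` and `∂^α u`: there is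
`N = N(m,d,K)` such that
`|∫ |∂^α(u(·+c(·)))(x)|² dx − ∫ |∂^α u(x)|² dx| ≤ N ε Σ_{|ζ| ≤ m} ∫ |∂^ζ u|² dx`. -/
theorem degenerate_SIDE_stmt10 (d m : ℕ) (hd : 1 ≤ d) (hm : 1 ≤ m) (K : ℝ) (hK : 0 < K) :
    ∃ N : ℝ, ∀ ε : ℝ, 0 < ε → ε ≤ K →
      ∀ c : EuclideanSpace ℝ (Fin d) → EuclideanSpace ℝ (Fin d),
        ContDiff ℝ ((m : ℕ∞) + 1) c →
        (∀ γ : Fin d → ℕ, (∑ i, γ i) ≤ m + 1 →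
          ∀ (i : Fin d) (x : EuclideanSpace ℝ (Fin d)), |mpd γ (fun y => c y i) x| ≤ ε) →
        (∀ (x : EuclideanSpace ℝ (Fin d)), ∀ θ ∈ Set.Icc (0 : ℝ) 1,
          K⁻¹ ≤ |((1 : Matrix (Fin d) (Fin d) ℝ) + θ • jac c x).det|) →
        ∀ u : EuclideanSpace ℝ (Fin d) → ℝ,
          ContDiff ℝ ((m : ℕ∞) + 1) u → HasCompactSupport u →
          ∀ α : Fin d → ℕ, (∑ i, α i) ≤ m →
            |(∫ x, |mpd α (fun y => u (y + c y)) x| ^ 2) - ∫ x, |mpd α u x| ^ 2| ≤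
              N * ε * ∑ ζ ∈ midx d m, ∫ x, |mpd ζ u x| ^ 2 := by
  obtain ⟨N₁, hN₁, hcomp⟩ := exists_abs_dlist_comp_add_sub_le d K hK.le m
  obtain ⟨N₂, hN₂, hdetN⟩ := exists_abs_one_sub_det_le d K
  set C := N₁ * (N₁ * K + 2) * (midx d m).card + N₂ with hC
  refine ⟨C * K, fun ε hε hεK c hc hcε hdet u hu hus α hα => ?_⟩
  have hc : ContDiff ℝ (m + 1 : ℕ) c := mod_cast hc
  have hu : ContDiff ℝ (m + 1 : ℕ) u := mod_cast hu
  have hcd : Differentiable ℝ c := differentiable_of_contDiff_succ hc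
  have hclist (M : List (Fin d)) (hM : M.length ≤ m + 1) (i : Fin d)
      (x : EuclideanSpace ℝ (Fin d)) : |dlist M (fun y => c y i) x| ≤ ε := by
    rw [dlist_eq_mpd M (((contDiff_euclidean.mp hc) i).of_le (by norm_cast))]
    exact hcε _ (by rwa [sum_count]) i x
  have hjac (x : EuclideanSpace ℝ (Fin d)) (i j : Fin d) : |jac c x i j| ≤ ε :=
    hclist [j] (by simp) i x
  obtain ⟨T, hT⟩ := exists_homeomorph_add (C := d * (d * ε)) hcd (inv_pos.mpr hK)
    (fun x => (norm_le_sum_abs_entries _).trans (by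
      refine (Finset.sum_le_sum fun j _ => Finset.sum_le_sum fun i _ => ?_).trans_eq
        (b := ∑ _j : Fin d, ∑ _i : Fin d, ε) (by simp)
      rw [← fderiv_coord (hcd x)]
      exact hjac x i j))
    (fun x θ hθ => by rw [det_id_add_smul_fderiv (hcd x)]; exact hdet x θ hθ)
  have hTfun : (T : EuclideanSpace ℝ (Fin d) → EuclideanSpace ℝ (Fin d)) = fun x => x + c x :=
    funext hT
  set D : EuclideanSpace ℝ (Fin d) → EuclideanSpace ℝ (Fin d) →L[ℝ] EuclideanSpace ℝ (Fin d) :=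
    fun x => ContinuousLinearMap.id ℝ _ + fderiv ℝ c x with hD
  have hTder (x : EuclideanSpace ℝ (Fin d)) : HasFDerivAt T (D x) x := by
    rw [hTfun]
    exact (hasFDerivAt_id x).add (hcd x).hasFDerivAt
  have hDdet (x : EuclideanSpace ℝ (Fin d)) :
      (D x).det = ((1 : Matrix (Fin d) (Fin d) ℝ) + jac c x).det := by
    simpa using det_id_add_smul_fderiv (hcd x) 1
  have hDlow (x : EuclideanSpace ℝ (Fin d)) : K⁻¹ ≤ |(D x).det| := by
    rw [hDdet]
    simpa using hdet x 1 (by simp)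
  have hDsub (x : EuclideanSpace ℝ (Fin d)) : |(1 - |(D x).det|)| ≤ N₂ * ε := by
    rw [hDdet]
    exact hdetN ε hε.le hεK _ (hjac x)
  have hDcont : Continuous fun x => |(D x).det| :=
    (ContinuousLinearMap.continuous_det.comp
      (continuous_const.add (hc.continuous_fderiv (by norm_cast)))).abs
  have hmpd (f : EuclideanSpace ℝ (Fin d) → ℝ) (hf : ContDiff ℝ (m + 1 : ℕ) f)
      (hfs : HasCompactSupport f) (ζ : Fin d → ℕ) (hζ : ∑ i, ζ i ≤ m) :
      Continuous (mpd ζ f) ∧ HasCompactSupport (mpd ζ f) := by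
    rw [mpd_eq_dlist]
    refine ⟨(contDiff_dlist (n := 0) _ (hf.of_le ?_)).continuous, hasCompactSupport_dlist _ hfs⟩
    rw [length_dirs]
    norm_cast
    omega
  have hsq {f : EuclideanSpace ℝ (Fin d) → ℝ} (hf : HasCompactSupport f) :
      HasCompactSupport fun x => |f x| ^ 2 := hf.comp_left (g := fun t : ℝ => |t| ^ 2) (by simp)
  have hwcs : HasCompactSupport fun y => u (y + c y) := by
    have h := hus.comp_homeomorph T
    rwa [hTfun] at h
  obtain ⟨hwc, hws⟩ := hmpd (fun y => u (y + c y)) (hu.comp (contDiff_id.add hc)) hwcs α hα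
  obtain ⟨hvc, hvs⟩ := hmpd u hu hus α hα
  set w := mpd α fun y => u (y + c y) with hw
  set v := mpd α u with hv
  set G : EuclideanSpace ℝ (Fin d) → ℝ := fun y => ∑ ζ ∈ midx d m, |mpd ζ u y| ^ 2 with hG
  have hGint : ∫ y, G y = ∑ ζ ∈ midx d m, ∫ x, |mpd ζ u x| ^ 2 :=
    integral_finsetSum _ fun ζ hζ => by
      obtain ⟨h1, h2⟩ := hmpd u hu hus ζ (mem_midx.mp hζ)
      exact (h1.abs.pow 2).integrable_of_hasCompactSupport (hsq h2)
  have hGc : Continuous G := continuous_finsetSum _ fun ζ hζ =>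
    ((hmpd u hu hus ζ (mem_midx.mp hζ)).1.abs.pow 2)
  have hGs : HasCompactSupport G := by
    rw [show G = ∑ ζ ∈ midx d m, fun y => |mpd ζ u y| ^ 2 by ext; simp [hG]]
    exact Finset.sum_induction _ HasCompactSupport (fun _ _ => HasCompactSupport.add)
      HasCompactSupport.zero fun ζ hζ => hsq (hmpd u hu hus ζ (mem_midx.mp hζ)).2
  have hG0 (y : EuclideanSpace ℝ (Fin d)) : 0 ≤ G y := by positivity
  have hptw (x : EuclideanSpace ℝ (Fin d)) :
      |(|w x| ^ 2 - |(D x).det| * |v (T x)| ^ 2)| ≤ C * ε * G (T x) := by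
    set A := ∑ ζ ∈ midx d m, |mpd ζ u (T x)| with hA
    have hAnn : 0 ≤ A := by positivity
    have hAle (ζ : Fin d → ℕ) (hζ : ∑ i, ζ i ≤ m) : |mpd ζ u (T x)| ≤ A :=
      Finset.single_le_sum (f := fun ζ => |mpd ζ u (T x)|) (fun _ _ => abs_nonneg _)
        (mem_midx.mpr hζ)
    have hAG : A ^ 2 ≤ (midx d m).card * G (T x) := sq_sum_le_card_mul_sum_sq
    have hwv : |w x - v (T x)| ≤ N₁ * ε * A := by
      rw [hw, hv, mpd_eq_dlist, mpd_eq_dlist, hT x]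
      refine hcomp ε hε.le hεK c (hc.of_le (by norm_cast; omega)) x
        (fun M hM i => hclist M (by omega) i x) u (hu.of_le (by norm_cast; omega)) A
        (fun M hM => ?_) _ (by rwa [length_dirs])
      rw [dlist_eq_mpd M (hu.of_le (by norm_cast; omega)), ← hT x]
      exact hAle _ (by rwa [sum_count])
    have hvA : |v (T x)| ≤ A := hAle α hα
    have hvG : |v (T x)| ^ 2 ≤ G (T x) :=
      Finset.single_le_sum (f := fun ζ => |mpd ζ u (T x)| ^ 2) (fun _ _ => by positivity)
        (mem_midx.mpr hα)
    have hsum : |w x + v (T x)| ≤ (N₁ * K + 2) * A := by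
      have h1 : |w x + v (T x)| ≤ |w x - v (T x)| + 2 * |v (T x)| := by
        calc _ = |(w x - v (T x)) + 2 * v (T x)| := by ring_nf
          _ ≤ _ := (abs_add_le _ _).trans_eq (by rw [abs_mul, abs_two])
      have h2 : N₁ * ε * A ≤ N₁ * K * A := by gcongr
      linarith
    have hsplit : |w x| ^ 2 - |(D x).det| * |v (T x)| ^ 2 =
        (w x - v (T x)) * (w x + v (T x)) + (1 - |(D x).det|) * |v (T x)| ^ 2 := by
      simp only [sq_abs]
      ring
    rw [hsplit]
    refine (abs_add_le _ _).trans ?_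
    rw [abs_mul, abs_mul, abs_of_nonneg (sq_nonneg |v (T x)|)]
    calc _ ≤ N₁ * ε * A * ((N₁ * K + 2) * A) + N₂ * ε * G (T x) :=
          add_le_add (mul_le_mul hwv hsum (abs_nonneg _) (by positivity))
            (mul_le_mul (hDsub x) hvG (by positivity) (by positivity))
      _ = N₁ * (N₁ * K + 2) * ε * A ^ 2 + N₂ * ε * G (T x) := by ring
      _ ≤ N₁ * (N₁ * K + 2) * ε * ((midx d m).card * G (T x)) + N₂ * ε * G (T x) := by gcongr
      _ = C * ε * G (T x) := by rw [hC]; ring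
  have hwint : Integrable fun x => |w x| ^ 2 :=
    (hwc.abs.pow 2).integrable_of_hasCompactSupport (hsq hws)
  have hvint : Integrable fun x => |(D x).det| * |v (T x)| ^ 2 :=
    (hDcont.mul ((hvc.comp T.continuous).abs.pow 2)).integrable_of_hasCompactSupport
      (hsq (hvs.comp_homeomorph T)).mul_left
  have hGTint : Integrable fun x => G (T x) :=
    (hGc.comp T.continuous).integrable_of_hasCompactSupport (hGs.comp_homeomorph T)
  have hDGint : Integrable fun x => |(D x).det| * G (T x) :=
    (hDcont.mul (hGc.comp T.continuous)).integrable_of_hasCompactSupport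
      (hGs.comp_homeomorph T).mul_left
  have hGT : ∫ x, G (T x) ≤ K * ∫ y, G y := by
    rw [← integral_comp_homeomorph_eq volume T hTder G, ← integral_const_mul]
    refine integral_mono hGTint (hDGint.const_mul K) fun x => ?_
    have h1 : 1 ≤ K * |(D x).det| := by
      calc (1 : ℝ) = K * K⁻¹ := (mul_inv_cancel₀ hK.ne').symm
        _ ≤ _ := mul_le_mul_of_nonneg_left (hDlow x) hK.le
    calc G (T x) ≤ K * |(D x).det| * G (T x) := le_mul_of_one_le_left (hG0 _) h1
      _ = _ := by ring
  rw [← hGint, ← integral_comp_homeomorph_eq volume T hTder fun x => |v x| ^ 2,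
    ← integral_sub hwint hvint]
  have hle := norm_integral_le_of_norm_le
    (f := fun x => |w x| ^ 2 - |(D x).det| * |v (T x)| ^ 2) (hGTint.const_mul (C * ε))
    (Filter.Eventually.of_forall hptw)
  rw [integral_const_mul] at hle
  calc _ ≤ C * ε * ∫ x, G (T x) := hle
    _ ≤ C * ε * (K * ∫ y, G y) := by gcongr
    _ = _ := by ring
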